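/- For every β > 0, the canonical expectation of the number of excited particles stays bounded as N → ∞, with limsup_{N→∞} ⟨N'⟩_N ≤ inf over μ with 0 < μ < ε 1 − ε 0 of (Q(β,μ)/Q(β,0)) · (1 − exp(−β μ))^{−2}. In particular the expected number of particles outside the one-particle ground state remains finite at every temperature (100% condensation). -/

import Mathlib

open scoped BigOperators
open Filter

noncomputable section

/-- The particle number of a configuration `n : ℕ →₀ ℕ`. -/
def particleNumber (n : ℕ →₀ ℕ) : ℕ := n.sum fun _ k => k

/-- The energy of a configuration `n`, with one-particle levels `ε`. -/
def energy (ε : ℕ → ℝ) (n : ℕ →₀ ℕ) : ℝ := n.sum fun j k => (k : ℝ) * ε j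

/-- The canonical partition function of `N` bosons at inverse temperature `β`. -/
def Z (ε : ℕ → ℝ) (β : ℝ) (N : ℕ) : ℝ :=
  ∑' n : {n : ℕ →₀ ℕ // particleNumber n = N}, Real.exp (-β * energy ε n)

/-- The canonical expectation of `f` among configurations with particle number `N`. -/
def expect (ε : ℕ → ℝ) (β : ℝ) (N : ℕ) (f : (ℕ →₀ ℕ) → ℝ) : ℝ :=
  (∑' n : {n : ℕ →₀ ℕ // particleNumber n = N},
      f n * Real.exp (-β * energy ε n)) / Z ε β N

/-- `Q(β,μ) = ∏_{j=1}^∞ (1 - exp (-β (ε j - ε 0 - μ)))⁻¹`. -/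
def Q (ε : ℕ → ℝ) (β μ : ℝ) : ℝ :=
  ∏' j : ℕ, (1 - Real.exp (-β * (ε (j + 1) - ε 0 - μ)))⁻¹

section FinsuppSeries

variable {ι : Type*} {x : ι → ℝ}

theorem multipliable_one_sub_inv (h0 : ∀ j, 0 ≤ x j) (h1 : ∀ j, x j < 1) (hs : Summable x) :
    Multipliable fun j => (1 - x j)⁻¹ := by
  have hsum : Summable fun j => x j / (1 - x j) := by
    refine (hs.mul_left 2).of_norm_bounded_eventually ?_
    have hlim := hs.tendsto_cofinite_zero.eventually (gt_mem_nhds (show (0 : ℝ) < 1 / 2 by norm_num))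
    filter_upwards [hlim] with j hj
    rw [Real.norm_of_nonneg (div_nonneg (h0 j) (sub_nonneg.2 (h1 j).le)),
      div_le_iff₀ (sub_pos.2 (h1 j))]
    nlinarith [h0 j]
  refine (Real.multipliable_one_add_of_summable hsum).congr fun j => ?_
  have := sub_pos.2 (h1 j)
  field_simp
  ring

theorem prod_le_tprod_of_one_le {f : ι → ℝ} (hf : ∀ j, 1 ≤ f j) (hm : Multipliable f)
    (s : Finset ι) : ∏ j ∈ s, f j ≤ ∏' j, f j := by
  classical
  refine ge_of_tendsto hm.hasProd ?_
  filter_upwards [eventually_ge_atTop s] with t ht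
  exact Finset.prod_le_prod_of_subset_of_one_le ht
    (fun j _ => zero_le_one.trans (hf j)) fun j _ _ => hf j

theorem sum_finsupp_range_prod_pow (s : Finset ι) (K : ℕ) :
    ∑ m ∈ s.finsupp (fun _ => Finset.range K), (m.prod fun j k => x j ^ k) =
      ∏ j ∈ s, ∑ k ∈ Finset.range K, x j ^ k := by
  classical
  rw [Finset.prod_sum, Finset.finsupp, Finset.sum_map]
  refine Finset.sum_congr (by congr) fun p _ => ?_
  exact Finsupp.prod_indicator_index_eq_prod_attach p fun j _ => pow_zero (x j)

/-- The generating function of configurations: `∑_m ∏_j x_j ^ m_j = ∏_j (1 - x_j)⁻¹`. -/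
theorem hasSum_finsupp_prod_pow (h0 : ∀ j, 0 ≤ x j) (h1 : ∀ j, x j < 1) (hs : Summable x) :
    HasSum (fun m : ι →₀ ℕ => m.prod fun j k => x j ^ k) (∏' j, (1 - x j)⁻¹) := by
  classical
  have hm := multipliable_one_sub_inv h0 h1 hs
  have hone (j : ι) : 1 ≤ (1 - x j)⁻¹ :=
    (one_le_inv₀ (sub_pos.2 (h1 j))).2 (sub_le_self 1 (h0 j))
  have hnonneg (m : ι →₀ ℕ) : 0 ≤ m.prod fun j k => x j ^ k :=
    Finset.prod_nonneg fun j _ => pow_nonneg (h0 j) _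
  have hbound (u : Finset (ι →₀ ℕ)) :
      ∑ m ∈ u, (m.prod fun j k => x j ^ k) ≤ ∏' j, (1 - x j)⁻¹ := by
    set s := u.biUnion fun m => m.support
    set K := (u.sup fun m => m.support.sup m) + 1
    have hsub : u ⊆ s.finsupp fun _ => Finset.range K := by
      intro m hmu
      refine Finset.mem_finsupp_iff.2
        ⟨Finset.subset_biUnion_of_mem (fun m : ι →₀ ℕ => m.support) hmu, fun j _ => ?_⟩
      rw [Finset.mem_range, Nat.lt_succ_iff]
      by_cases hj : j ∈ m.support
      · exact (Finset.le_sup (f := m) hj).trans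
          (Finset.le_sup (f := fun m : ι →₀ ℕ => m.support.sup m) hmu)
      · simp [Finsupp.notMem_support_iff.1 hj]
    calc ∑ m ∈ u, (m.prod fun j k => x j ^ k)
        ≤ ∑ m ∈ s.finsupp (fun _ => Finset.range K), (m.prod fun j k => x j ^ k) :=
          Finset.sum_le_sum_of_subset_of_nonneg hsub fun m _ _ => hnonneg m
      _ = ∏ j ∈ s, ∑ k ∈ Finset.range K, x j ^ k := sum_finsupp_range_prod_pow s K
      _ ≤ ∏ j ∈ s, (1 - x j)⁻¹ := by
          refine Finset.prod_le_prod
            (fun j _ => Finset.sum_nonneg fun k _ => pow_nonneg (h0 j) k) fun j _ => ?_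
          exact (tsum_geometric_of_lt_one (h0 j) (h1 j)) ▸
            (summable_geometric_of_lt_one (h0 j) (h1 j)).sum_le_tsum _
              fun k _ => pow_nonneg (h0 j) k
      _ ≤ ∏' j, (1 - x j)⁻¹ := prod_le_tprod_of_one_le hone hm s
  have hsummable := summable_of_sum_le hnonneg hbound
  refine hsummable.hasSum_iff.2 (le_antisymm (hsummable.tsum_le_of_sum_le hbound) ?_)
  refine le_of_tendsto' hm.hasProd fun s => ?_
  refine le_of_tendsto' (tendsto_finsetProd s fun j _ =>
    (hasSum_geometric_of_lt_one (h0 j) (h1 j)).tendsto_sum_nat) fun K => ?_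
  rw [← sum_finsupp_range_prod_pow]
  exact hsummable.sum_le_tsum _ fun m _ => hnonneg m

end FinsuppSeries

/-- The occupation numbers of the excited levels, with level `j + 1` relabelled as `j`. -/
def excited (n : ℕ →₀ ℕ) : ℕ →₀ ℕ := n.comapDomain Nat.succ Nat.succ_injective.injOn

theorem excited_apply (n : ℕ →₀ ℕ) (j : ℕ) : excited n j = n (j + 1) := rfl

theorem sum_eq_add_sum_excited {M : Type*} [AddCommMonoid M] (n : ℕ →₀ ℕ) (f : ℕ → ℕ → M)
    (hf : ∀ j, f j 0 = 0) :
    n.sum f = f 0 (n 0) + (excited n).sum fun j k => f (j + 1) k := by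
  obtain ⟨K, hK⟩ := n.support.exists_nat_subset_range
  have hn : n.support ⊆ Finset.range (K + 1) :=
    hK.trans (Finset.range_subset_range.2 K.le_succ)
  have he : (excited n).support ⊆ Finset.range K := by
    intro j hj
    have hj' : j + 1 ∈ n.support := by
      rwa [Finsupp.mem_support_iff, ← excited_apply, ← Finsupp.mem_support_iff]
    have := Finset.mem_range.1 (hK hj')
    exact Finset.mem_range.2 (by omega)
  rw [Finsupp.sum_of_support_subset n hn f fun j _ => hf j,
    Finsupp.sum_of_support_subset _ he _ fun j _ => hf (j + 1), Finset.sum_range_succ', add_comm]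
  rfl

theorem particleNumber_eq_add (n : ℕ →₀ ℕ) :
    particleNumber n = n 0 + particleNumber (excited n) :=
  sum_eq_add_sum_excited n _ fun _ => rfl

theorem excited_injOn (N : ℕ) : Set.InjOn excited {n | particleNumber n = N} := by
  intro n hn n' hn' h
  ext j
  cases j with
  | zero =>
    have h1 := particleNumber_eq_add n
    have h2 := particleNumber_eq_add n'
    rw [Set.mem_ofPred_eq] at hn hn'
    rw [h] at h1
    omega
  | succ j => exact DFunLike.congr_fun h j

theorem exists_excited_eq {N : ℕ} {m : ℕ →₀ ℕ} (hm : particleNumber m ≤ N) :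
    ∃ n, particleNumber n = N ∧ excited n = m := by
  set n : ℕ →₀ ℕ := m.mapDomain Nat.succ + Finsupp.single 0 (N - particleNumber m) with hn
  have h0 : n 0 = N - particleNumber m := by
    rw [hn, Finsupp.add_apply, Finsupp.mapDomain_of_notMem_range _ _ (by simp)]
    simp
  have he : excited n = m := by
    ext j
    rw [excited_apply, hn, Finsupp.add_apply, ← Nat.succ_eq_add_one,
      Finsupp.mapDomain_apply Nat.succ_injective]
    simp
  exact ⟨n, by rw [particleNumber_eq_add, h0, he]; omega, he⟩

theorem tsum_excited (N : ℕ) (F : (ℕ →₀ ℕ) → ℝ) :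
    ∑' n : {n : ℕ →₀ ℕ // particleNumber n = N}, F (excited n) =
      ∑' m, if particleNumber m ≤ N then F m else 0 := by
  have hinj : Function.Injective
      fun n : {n : ℕ →₀ ℕ // particleNumber n = N} => excited n :=
    fun n n' h => Subtype.ext (excited_injOn N n.2 n'.2 h)
  rw [← hinj.tsum_eq]
  · refine tsum_congr fun n => (if_pos ?_).symm
    have := particleNumber_eq_add n
    have := n.2
    omega
  · intro m hm
    have hmN : particleNumber m ≤ N := by
      by_contra h
      exact hm (if_neg h)
    obtain ⟨n, hn, rfl⟩ := exists_excited_eq hmN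
    exact ⟨⟨n, hn⟩, rfl⟩

/-- The grand canonical weight of the excited occupation numbers `m` at chemical potential
`ε 0 + μ`. -/
def weight (ε : ℕ → ℝ) (β μ : ℝ) (m : ℕ →₀ ℕ) : ℝ :=
  m.prod fun j k => Real.exp (-β * (ε (j + 1) - ε 0 - μ)) ^ k

theorem weight_pos (ε : ℕ → ℝ) (β μ : ℝ) (m : ℕ →₀ ℕ) : 0 < weight ε β μ m :=
  Finset.prod_pos fun _ _ => pow_pos (Real.exp_pos _) _

theorem weight_eq_exp_mul (ε : ℕ → ℝ) (β μ : ℝ) (m : ℕ →₀ ℕ) :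
    weight ε β μ m = Real.exp (β * μ) ^ particleNumber m * weight ε β 0 m := by
  rw [weight, weight, particleNumber, Finsupp.prod, Finsupp.prod, Finsupp.sum,
    ← Finset.prod_pow_eq_pow_sum, ← Finset.prod_mul_distrib]
  refine Finset.prod_congr rfl fun j _ => ?_
  rw [← mul_pow, ← Real.exp_add]
  congr 2
  ring

theorem exp_energy (ε : ℕ → ℝ) (β : ℝ) (n : ℕ →₀ ℕ) :
    Real.exp (-β * energy ε n) =
      Real.exp (-β * ε 0) ^ particleNumber n * weight ε β 0 (excited n) := by
  have hw : weight ε β 0 (excited n) =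
      Real.exp (β * ε 0) ^ particleNumber (excited n) *
        Real.exp (-β * (excited n).sum fun j k => (k : ℝ) * ε (j + 1)) := by
    rw [weight, particleNumber, Finsupp.prod, Finsupp.sum, Finsupp.sum,
      ← Finset.prod_pow_eq_pow_sum, Finset.mul_sum, Real.exp_sum, ← Finset.prod_mul_distrib]
    refine Finset.prod_congr rfl fun j _ => ?_
    rw [← Real.exp_nat_mul, ← Real.exp_nat_mul, ← Real.exp_add]
    congr 1
    ring
  rw [energy, sum_eq_add_sum_excited n _ (by simp), particleNumber_eq_add, hw,
    ← Real.exp_nat_mul, ← Real.exp_nat_mul, ← Real.exp_add, ← Real.exp_add]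
  congr 1
  push_cast
  ring

theorem hasSum_weight {ε : ℕ → ℝ} (hmono : Monotone ε) {β μ : ℝ} (hβ : 0 < β)
    (hμ : μ < ε 1 - ε 0) (htrace : Summable fun j => Real.exp (-β * ε j)) :
    HasSum (weight ε β μ) (Q ε β μ) := by
  refine hasSum_finsupp_prod_pow (fun j => (Real.exp_pos _).le) (fun j => ?_) ?_
  · have := hmono (show 1 ≤ j + 1 by omega)
    rw [Real.exp_lt_one_iff]
    nlinarith
  · refine (((summable_nat_add_iff 1).2 htrace).mul_left (Real.exp (β * (ε 0 + μ)))).congr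
      fun j => ?_
    rw [← Real.exp_add]
    congr 1
    ring

theorem natCast_le_inv_sq_mul_exp_pow {x : ℝ} (hx : 0 < x) (k : ℕ) :
    (k : ℝ) ≤ ((1 - Real.exp (-x))⁻¹) ^ 2 * Real.exp x ^ k := by
  set q := Real.exp (-x) with hq
  have hq0 : 0 < q := Real.exp_pos _
  have hq1 : q < 1 := Real.exp_lt_one_iff.2 (by linarith)
  have hgeom : ∑ i ∈ Finset.range k, q ^ i ≤ (1 - q)⁻¹ :=
    tsum_geometric_of_lt_one hq0.le hq1 ▸
      (summable_geometric_of_lt_one hq0.le hq1).sum_le_tsum _ fun i _ => pow_nonneg hq0.le i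
  have hk : (k : ℝ) * q ^ k ≤ ∑ i ∈ Finset.range k, q ^ i := by
    simpa using Finset.card_nsmul_le_sum (Finset.range k) (fun i => q ^ i) (q ^ k)
      fun i hi => pow_le_pow_of_le_one hq0.le hq1.le (Finset.mem_range.1 hi).le
  have hone : 1 ≤ (1 - q)⁻¹ := (one_le_inv₀ (by linarith)).2 (by linarith)
  have hexp : Real.exp x = q⁻¹ := by rw [hq, Real.exp_neg, inv_inv]
  rw [hexp, inv_pow q, ← div_eq_mul_inv, le_div_iff₀ (pow_pos hq0 k)]
  exact (hk.trans hgeom).trans (le_self_pow₀ hone two_ne_zero)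

theorem expect_excited_eq (ε : ℕ → ℝ) (β : ℝ) (N : ℕ) :
    expect ε β N (fun n => ((N - n 0 : ℕ) : ℝ)) =
      (∑' m, if particleNumber m ≤ N then (particleNumber m : ℝ) * weight ε β 0 m else 0) /
        ∑' m, if particleNumber m ≤ N then weight ε β 0 m else 0 := by
  have hexp (n : {n : ℕ →₀ ℕ // particleNumber n = N}) : Real.exp (-β * energy ε n) =
      Real.exp (-β * ε 0) ^ N * weight ε β 0 (excited n) := by
    rw [exp_energy, n.2]
  have hnum (n : {n : ℕ →₀ ℕ // particleNumber n = N}) :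
      ((N - n.1 0 : ℕ) : ℝ) * Real.exp (-β * energy ε n) = Real.exp (-β * ε 0) ^ N *
        ((particleNumber (excited n) : ℝ) * weight ε β 0 (excited n)) := by
    have hN : N - n.1 0 = particleNumber (excited n) := by
      have := particleNumber_eq_add n
      have := n.2
      omega
    rw [hexp, hN]
    ring
  rw [expect, Z, tsum_congr hnum, tsum_congr hexp, tsum_mul_left, tsum_mul_left,
    mul_div_mul_left _ _ (pow_ne_zero N (Real.exp_pos _).ne'), ← tsum_excited N (weight ε β 0),
    ← tsum_excited N fun m => (particleNumber m : ℝ) * weight ε β 0 m]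

/-- For every `β > 0`, the canonical expectation of the number `N'(n) = N - n 0` of excited
particles stays bounded as `N → ∞`:
`limsup_N ⟨N'⟩_N ≤ inf_{0 < μ < ε 1 - ε 0} (Q(β,μ)/Q(β,0)) * (1 - exp (-β μ))⁻²`. -/
theorem limsup_expected_excited_particles_le (ε : ℕ → ℝ) (hmono : Monotone ε)
    (hgap : ε 0 < ε 1)
    (htrace : ∀ β : ℝ, 0 < β → Summable fun j => Real.exp (-β * ε j))
    (β : ℝ) (hβ : 0 < β) :
    Filter.limsup
        (fun N : ℕ => expect ε β N fun n : ℕ →₀ ℕ => ((N - n 0 : ℕ) : ℝ)) atTop ≤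
      ⨅ μ : {μ : ℝ // 0 < μ ∧ μ < ε 1 - ε 0},
        (Q ε β μ / Q ε β 0) * ((1 - Real.exp (-β * μ))⁻¹) ^ 2 := by
  have hsum0 : HasSum (weight ε β 0) (Q ε β 0) :=
    hasSum_weight hmono hβ (sub_pos.2 hgap) (htrace β hβ)
  have hQ0 : 0 < Q ε β 0 :=
    (weight_pos ε β 0 0).trans_le (hsum0.tsum_eq ▸ hsum0.summable.le_tsum 0
      fun m _ => (weight_pos ε β 0 m).le)
  have hden : Tendsto (fun N : ℕ => ∑' m, if particleNumber m ≤ N then weight ε β 0 m else 0)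
      atTop (nhds (Q ε β 0)) := by
    rw [← hsum0.tsum_eq]
    refine tendsto_tsum_of_dominated_convergence hsum0.summable (fun m => ?_)
      (Eventually.of_forall fun N m => ?_)
    · refine tendsto_const_nhds.congr' ?_
      filter_upwards [eventually_ge_atTop (particleNumber m)] with N hN
      rw [if_pos hN]
    · have := (weight_pos ε β 0 m).le
      split_ifs <;> simp [abs_of_nonneg, this]
  have hdiff : 0 < ε 1 - ε 0 := sub_pos.2 hgap
  have : Nonempty {μ : ℝ // 0 < μ ∧ μ < ε 1 - ε 0} :=
    ⟨⟨(ε 1 - ε 0) / 2, half_pos hdiff, half_lt_self hdiff⟩⟩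
  refine le_ciInf fun ⟨μ, hμ0, hμ1⟩ => ?_
  set C := ((1 - Real.exp (-β * μ))⁻¹) ^ 2 with hC
  have hsum : HasSum (weight ε β μ) (Q ε β μ) := hasSum_weight hmono hβ hμ1 (htrace β hβ)
  have hle (m : ℕ →₀ ℕ) : (particleNumber m : ℝ) * weight ε β 0 m ≤ C * weight ε β μ m := by
    rw [weight_eq_exp_mul ε β μ, ← mul_assoc, hC, neg_mul]
    exact mul_le_mul_of_nonneg_right (natCast_le_inv_sq_mul_exp_pow (mul_pos hβ hμ0) _)
      (weight_pos ε β 0 m).le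
  have hterm (m : ℕ →₀ ℕ) : 0 ≤ (particleNumber m : ℝ) * weight ε β 0 m :=
    mul_nonneg (Nat.cast_nonneg _) (weight_pos ε β 0 m).le
  have hnum (N : ℕ) :
      ∑' m, (if particleNumber m ≤ N then (particleNumber m : ℝ) * weight ε β 0 m else 0) ≤
        C * Q ε β μ := by
    have hN (m : ℕ →₀ ℕ) :
        (if particleNumber m ≤ N then (particleNumber m : ℝ) * weight ε β 0 m else 0) ≤
          C * weight ε β μ m := by
      split_ifs
      exacts [hle m, (hterm m).trans (hle m)]
    rw [← (hsum.mul_left C).tsum_eq]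
    refine Summable.tsum_le_tsum hN (.of_nonneg_of_le (fun m => ?_) hN (hsum.mul_left C).summable)
      (hsum.mul_left C).summable
    split_ifs
    exacts [hterm m, le_rfl]
  have hden_nonneg (N : ℕ) : 0 ≤ ∑' m, if particleNumber m ≤ N then weight ε β 0 m else 0 :=
    tsum_nonneg fun m => by
      split_ifs
      exacts [(weight_pos ε β 0 m).le, le_rfl]
  have hlim : Tendsto
      (fun N : ℕ => C * Q ε β μ / ∑' m, if particleNumber m ≤ N then weight ε β 0 m else 0)
      atTop (nhds (C * Q ε β μ / Q ε β 0)) := tendsto_const_nhds.div hden hQ0.ne'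
  have hnonneg (N : ℕ) : 0 ≤ expect ε β N fun n => ((N - n 0 : ℕ) : ℝ) := by
    rw [expect_excited_eq]
    refine div_nonneg (tsum_nonneg fun m => ?_) (hden_nonneg N)
    split_ifs
    exacts [hterm m, le_rfl]
  rw [show Q ε β μ / Q ε β 0 * C = C * Q ε β μ / Q ε β 0 by ring, ← hlim.limsup_eq]
  refine limsup_le_limsup (Eventually.of_forall fun N => ?_)
    (isBoundedUnder_of ⟨0, hnonneg⟩ : IsBoundedUnder (· ≥ ·) atTop _).isCoboundedUnder_le
    hlim.isBoundedUnder_le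
  beta_reduce
  rw [expect_excited_eq]
  exact div_le_div_of_nonneg_right (hnum N) (hden_nonneg N)
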